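/- Under assumptions (f₁)–(f₄), the map M : S → 𝒩 defined by M(u) = t_u u is a homeomorphism between the unit sphere S of H¹₀(Ω) and the Nehari manifold 𝒩 = {u ∈ X \ {0} : ⟨Φ′(u),u⟩ = 0}, with inverse M⁻¹(u) = u/‖u‖. -/

import Mathlib

open MeasureTheory Filter Topology Set in
/-- If `t ↦ ∫ K t` is continuous and not identically zero, nonnegative integrands that
are continuous in `t` and whose zero set does not depend on `t` are all integrable. -/
lemma integrable_of_continuous_integral {E : Type*} [MeasurableSpace E] {μ : Measure E}
    (K : ℝ → E → ℝ)
    (hKc : ∀ᵐ x ∂μ, Continuous fun t => K t x)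
    (hK0 : ∀ t, 0 ≤ᵐ[μ] K t)
    (hKz : ∀ t s, 0 < t → 0 < s → ∀ᵐ x ∂μ, K t x = 0 → K s x = 0)
    (hg : Continuous fun t => ∫ x, K t x ∂μ)
    (t₁ : ℝ) (ht₁ : 0 < t₁) (hne : ∫ x, K t₁ x ∂μ ≠ 0) :
    ∀ t, 0 < t → Integrable (K t) μ := by
  have hg0 : ∀ t, 0 ≤ ∫ x, K t x ∂μ := fun t => integral_nonneg_of_ae (hK0 t)
  have hint : ∀ t, 0 < ∫ x, K t x ∂μ → Integrable (K t) μ := by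
    intro t ht
    by_contra h
    rw [integral_undef h] at ht
    exact lt_irrefl _ ht
  have hsub : Ioi (0:ℝ) ⊆ {t | 0 < ∫ x, K t x ∂μ} := by
    refine isPreconnected_Ioi.subset_of_closure_inter_subset
      (isOpen_lt continuous_const hg) ⟨t₁, ht₁, lt_of_le_of_ne (hg0 _) hne.symm⟩ ?_
    rintro t ⟨htc, ht⟩
    obtain ⟨τ, hτ, hτt⟩ := mem_closure_iff_seq_limit.1 htc
    have hI : ∀ n, Integrable (K (τ n)) μ := fun n => hint _ (hτ n)
    have hlim : ∀ᵐ x ∂μ, Tendsto (fun n => K (τ n) x) atTop (𝓝 (K t x)) := by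
      filter_upwards [hKc] with x hx
      exact (hx.tendsto t).comp hτt
    have hIt : Integrable (K t) μ := by
      refine ⟨aestronglyMeasurable_of_tendsto_ae atTop (fun n => (hI n).1) hlim, ?_⟩
      have h1 : ∫⁻ x, ‖K t x‖ₑ ∂μ = ∫⁻ x, liminf (fun n => ‖K (τ n) x‖ₑ) atTop ∂μ := by
        refine lintegral_congr_ae ?_
        filter_upwards [hlim] with x hx
        exact hx.enorm.liminf_eq.symm
      have h2 : ∀ n, ∫⁻ x, ‖K (τ n) x‖ₑ ∂μ = ENNReal.ofReal (∫ x, K (τ n) x ∂μ) := by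
        intro n
        rw [ofReal_integral_eq_lintegral_ofReal (hI n) (hK0 _)]
        refine lintegral_congr_ae ?_
        filter_upwards [hK0 (τ n)] with x hx
        exact Real.enorm_of_nonneg hx
      have h3 : Tendsto (fun n => ENNReal.ofReal (∫ x, K (τ n) x ∂μ)) atTop
          (𝓝 (ENNReal.ofReal (∫ x, K t x ∂μ))) :=
        ENNReal.tendsto_ofReal ((hg.tendsto t).comp hτt)
      show ∫⁻ x, ‖K t x‖ₑ ∂μ < ⊤
      rw [h1]
      refine (lintegral_liminf_le' fun n => (hI n).1.enorm).trans_lt ?_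
      simp_rw [h2]
      rw [h3.liminf_eq]
      exact ENNReal.ofReal_lt_top
    refine lt_of_le_of_ne (hg0 t) fun h0 => hne ?_
    have hz := (integral_eq_zero_iff_of_nonneg_ae (hK0 t) hIt).1 h0.symm
    refine integral_eq_zero_of_ae ?_
    filter_upwards [hz, hKz t t₁ ht ht₁] with x hx hx'
    exact hx' hx
  exact fun t ht => hint t (hsub ht)

open Set in
/-- Convexity of `s ↦ G (s^{1/4} w)`. -/
lemma convexOn_quarter (g G : ℝ → ℝ) (hg : Continuous g)
    (hG : ∀ u, G u = ∫ s in (0:ℝ)..u, g s)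
    (hmono : MonotoneOn (fun u => g u / u ^ 3) (Ioi (0:ℝ)))
    (hanti : AntitoneOn (fun u => g u / u ^ 3) (Iio (0:ℝ))) (w : ℝ) :
    ConvexOn ℝ (Ioi (0:ℝ)) fun s => G (s ^ (1/4:ℝ) * w) := by
  have hd : ∀ u, HasDerivAt G (g u) u := by
    intro u
    have : G = fun u => ∫ s in (0:ℝ)..u, g s := funext hG
    rw [this]
    exact intervalIntegral.integral_hasDerivAt_right (hg.intervalIntegrable _ _)
      (hg.stronglyMeasurableAtFilter _ _) hg.continuousAt
  have hk : ∀ s ∈ Ioi (0:ℝ), HasDerivAt (fun s => G (s ^ (1/4:ℝ) * w))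
      (g (s ^ (1/4:ℝ) * w) * ((1/4:ℝ) * s ^ ((1/4:ℝ) - 1) * w)) s := by
    intro s hs
    exact (hd _).comp s ((Real.hasDerivAt_rpow_const (Or.inl (ne_of_gt hs))).mul_const w)
  refine MonotoneOn.convexOn_of_deriv (convex_Ioi 0)
    (fun s hs => (hk s hs).continuousAt.continuousWithinAt) ?_ ?_
  · rw [interior_Ioi]
    exact fun s hs => (hk s hs).differentiableAt.differentiableWithinAt
  · rw [interior_Ioi]
    have hder : ∀ s ∈ Ioi (0:ℝ), w ≠ 0 → deriv (fun s => G (s ^ (1/4:ℝ) * w)) s =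
        (1/4 * w ^ 4) * (g (s ^ (1/4:ℝ) * w) / (s ^ (1/4:ℝ) * w) ^ 3) := by
      intro s hs hw
      have hs' : 0 < s := hs
      rw [(hk s hs).deriv, Real.rpow_sub hs', Real.rpow_one]
      have hq : 0 < s ^ (1/4:ℝ) := Real.rpow_pos_of_pos hs' _
      have hq4 : (s ^ (1/4:ℝ)) ^ 4 = s := by
        rw [← Real.rpow_natCast, ← Real.rpow_mul hs'.le]; norm_num
      generalize s ^ (1/4:ℝ) = q at *
      subst hq4
      field_simp
    rcases eq_or_ne w 0 with hw | hw
    · subst hw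
      intro s hs t ht hst
      simp
    · intro s hs t ht hst
      rw [hder s hs hw, hder t ht hw]
      have hs' : 0 < s := hs
      have hq : 0 < s ^ (1/4:ℝ) := Real.rpow_pos_of_pos hs' _
      have hqt : 0 < t ^ (1/4:ℝ) := Real.rpow_pos_of_pos ht _
      have hle : s ^ (1/4:ℝ) ≤ t ^ (1/4:ℝ) := Real.rpow_le_rpow hs'.le hst (by norm_num)
      refine mul_le_mul_of_nonneg_left ?_ (by positivity)
      rcases lt_or_gt_of_ne hw with hw | hw
      · exact hanti (mul_neg_of_pos_of_neg hqt hw) (mul_neg_of_pos_of_neg hq hw)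
          (mul_le_mul_of_nonpos_right hle hw.le)
      · exact hmono (mul_pos hq hw) (mul_pos hqt hw)
          (mul_le_mul_of_nonneg_right hle hw.le)

/-- Positivity of the primitive. -/
lemma primitive_pos (g G : ℝ → ℝ) (hg : Continuous g)
    (hG : ∀ u, G u = ∫ s in (0:ℝ)..u, g s)
    (hpos : ∀ u, u ≠ 0 → 0 < g u / u ^ 3) (u : ℝ) (hu : u ≠ 0) : 0 < G u := by
  rw [hG]
  rcases lt_or_gt_of_ne hu with h | h
  · rw [intervalIntegral.integral_symm, ← intervalIntegral.integral_neg]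
    refine intervalIntegral.intervalIntegral_pos_of_pos_on
      (hg.neg.intervalIntegrable _ _) ?_ h
    intro x hx
    have h1 := hpos x hx.2.ne
    have h3 : x ^ 3 < 0 := Odd.pow_neg (by decide) hx.2
    have h4 : g x < 0 := by
      rcases div_pos_iff.1 h1 with h | h
      · linarith [h.2]
      · exact h.1
    linarith
  · refine intervalIntegral.intervalIntegral_pos_of_pos_on (hg.intervalIntegrable _ _) ?_ h
    intro x hx
    have h1 := hpos x hx.1.ne'
    have h3 : 0 < x ^ 3 := pow_pos hx.1 3
    exact (div_pos_iff_of_pos_right h3).1 h1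

open Set Filter Topology in
/-- The abstract part: concavity of `s ↦ Φ (s^{1/4} u)` gives the homeomorphism. -/
lemma nehari_abstract {X : Type*} [NormedAddCommGroup X] [InnerProductSpace ℝ X]
    (Φ : X → ℝ) (Φ' : X → X →L[ℝ] ℝ) (hΦ' : ∀ u : X, HasFDerivAt Φ (Φ' u) u)
    (tu : X → ℝ)
    (htu : ∀ u : X, u ≠ 0 → 0 < tu u ∧
      ∀ t : ℝ, 0 < t → t ≠ tu u → Φ (t • u) < Φ (tu u • u))
    (hconc : ∀ u : X, u ≠ 0 → ConcaveOn ℝ (Ioi (0:ℝ)) fun s => Φ (s ^ (1/4:ℝ) • u)) :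
    ∃ M : {u : X // ‖u‖ = 1} ≃ₜ {u : X // u ≠ 0 ∧ Φ' u u = 0},
      (∀ u : {u : X // ‖u‖ = 1}, (M u : X) = tu u • (u : X)) ∧
      (∀ v : {u : X // u ≠ 0 ∧ Φ' u u = 0},
        (M.symm v : X) = ‖(v : X)‖⁻¹ • (v : X)) := by
  have hΦc : Continuous Φ := continuous_iff_continuousAt.2 fun u => (hΦ' u).continuousAt
  have hne : ∀ u : {u : X // ‖u‖ = 1}, (u : X) ≠ 0 := fun u h => by
    have := u.2; rw [h, norm_zero] at this; exact zero_ne_one this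
  have hray : ∀ (u : X) (t : ℝ), HasDerivAt (fun t : ℝ => Φ (t • u)) (Φ' (t • u) u) t := by
    intro u t
    have h := (hasDerivAt_id t).smul_const u
    simp only [id, one_smul] at h
    exact (hΦ' (t • u)).comp_hasDerivAt t h
  have hq4 : ∀ t : ℝ, 0 < t → (t ^ 4) ^ (1/4:ℝ) = t := by
    intro t ht
    rw [← Real.rpow_natCast, ← Real.rpow_mul ht.le]; norm_num
  have hmax : ∀ u : X, u ≠ 0 → Φ' (tu u • u) u = 0 := by
    intro u hu
    have hloc : IsLocalMax (fun t : ℝ => Φ (t • u)) (tu u) := by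
      filter_upwards [Ioi_mem_nhds (htu u hu).1] with t ht
      rcases eq_or_ne t (tu u) with h | h
      · rw [h]
      · exact ((htu u hu).2 t ht h).le
    exact hloc.hasDerivAt_eq_zero (hray u _)
  have hcrit : ∀ (u : X) (t : ℝ), u ≠ 0 → 0 < t → Φ' (t • u) u = 0 → t = tu u := by
    intro u t hu ht h0
    by_contra hcon
    have hlt := (htu u hu).2 t ht hcon
    have htp := (htu u hu).1
    have hd : HasDerivAt (fun s : ℝ => Φ (s ^ (1/4:ℝ) • u)) 0 (t ^ 4) := by
      have h1 := Real.hasDerivAt_rpow_const (x := t ^ 4) (p := (1/4:ℝ))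
        (Or.inl (pow_pos ht 4).ne')
      have h2 := hray u ((t ^ 4) ^ (1/4:ℝ))
      have h3 := h2.comp (t ^ 4) h1
      rw [hq4 t ht, h0, zero_mul] at h3
      exact h3
    have hC := hconc u hu
    rcases lt_or_gt_of_ne hcon with h | h
    · have h4 : t ^ 4 < tu u ^ 4 := by gcongr
      have := hC.slope_le_of_hasDerivAt (mem_Ioi.2 (pow_pos ht 4))
        (mem_Ioi.2 (pow_pos htp 4)) h4 hd
      rw [slope_def_field, hq4 _ ht, hq4 _ htp] at this
      have h5 : 0 < (Φ (tu u • u) - Φ (t • u)) / (tu u ^ 4 - t ^ 4) :=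
        div_pos (by linarith) (by linarith)
      linarith
    · have h4 : tu u ^ 4 < t ^ 4 := by gcongr
      have := hC.le_slope_of_hasDerivAt (mem_Ioi.2 (pow_pos htp 4))
        (mem_Ioi.2 (pow_pos ht 4)) h4 hd
      rw [slope_def_field, hq4 _ ht, hq4 _ htp] at this
      have h5 : (Φ (t • u) - Φ (tu u • u)) / (t ^ 4 - tu u ^ 4) < 0 :=
        div_neg_of_neg_of_pos (by linarith) (by linarith)
      linarith
  -- unimodality
  have huni : ∀ (u : X) (x y z : ℝ), u ≠ 0 → 0 < x → x ≤ y → y ≤ z →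
      min (Φ (x • u)) (Φ (z • u)) ≤ Φ (y • u) := by
    intro u x y z hu hx hxy hyz
    have hy := hx.trans_le hxy
    have hz := hy.trans_le hyz
    have := (hconc u hu).min_le_of_mem_Icc (mem_Ioi.2 (pow_pos hx 4))
      (mem_Ioi.2 (pow_pos hz 4)) (z := y ^ 4) ⟨by gcongr, by gcongr⟩
    simpa only [hq4 _ hx, hq4 _ hy, hq4 _ hz] using this
  have htc : Continuous fun u : {u : X // ‖u‖ = 1} => tu (u : X) := by
    refine continuous_iff_continuousAt.2 fun u => ?_
    have hu := hne u
    obtain ⟨htp, hstr⟩ := htu u hu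
    have hcont : ∀ t : ℝ, Continuous fun v : {u : X // ‖u‖ = 1} => Φ (t • (v : X)) :=
      fun t => hΦc.comp (continuous_subtype_val.const_smul t)
    have hup : ∀ z : ℝ, tu (u : X) < z → ∀ᶠ v : {u : X // ‖u‖ = 1} in 𝓝 u, tu (v : X) < z := by
      intro z hz
      filter_upwards [(hcont z).continuousAt.eventually_lt (hcont (tu (u:X))).continuousAt
        (hstr z (htp.trans hz) hz.ne')] with v hv
      by_contra! hcon
      obtain ⟨hvp, hvs⟩ := htu v (hne v)
      have h1 := huni v _ _ _ (hne v) htp hz.le hcon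
      have h2 := hvs (tu (u:X)) htp (by linarith)
      rw [min_eq_left h2.le] at h1
      linarith
    have hlo : ∀ z : ℝ, 0 < z → z < tu (u : X) →
        ∀ᶠ v : {u : X // ‖u‖ = 1} in 𝓝 u, z < tu (v : X) := by
      intro z hz0 hz
      filter_upwards [(hcont z).continuousAt.eventually_lt (hcont (tu (u:X))).continuousAt
        (hstr z hz0 hz.ne)] with v hv
      by_contra! hcon
      obtain ⟨hvp, hvs⟩ := htu v (hne v)
      have h1 := huni v _ _ _ (hne v) hvp hcon hz.le
      have h2 := hvs (tu (u:X)) htp (by linarith)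
      rw [min_eq_right h2.le] at h1
      linarith
    refine tendsto_order.2 ⟨fun z hz => ?_, hup⟩
    rcases lt_or_ge 0 z with h | h
    · exact hlo z h hz
    · exact Eventually.of_forall fun v => h.trans_lt (htu v (hne v)).1
  let e : {u : X // ‖u‖ = 1} ≃ {u : X // u ≠ 0 ∧ Φ' u u = 0} :=
    { toFun := fun u => ⟨tu (u:X) • (u:X),
        smul_ne_zero (htu u (hne u)).1.ne' (hne u), by
          rw [map_smul, hmax u (hne u), smul_zero]⟩
      invFun := fun v => ⟨‖(v:X)‖⁻¹ • (v:X), by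
          rw [norm_smul, norm_inv, norm_norm, inv_mul_cancel₀ (norm_ne_zero_iff.2 v.2.1)]⟩
      left_inv := fun u => by
        apply Subtype.ext
        have hp := (htu u (hne u)).1
        simp only [norm_smul, u.2, mul_one, Real.norm_eq_abs, abs_of_pos hp, smul_smul]
        rw [inv_mul_cancel₀ hp.ne', one_smul]
      right_inv := fun v => by
        apply Subtype.ext
        have hn : 0 < ‖(v:X)‖ := norm_pos_iff.2 v.2.1
        have hw : ‖(v:X)‖ • (‖(v:X)‖⁻¹ • (v:X)) = (v:X) := by
          rw [smul_smul, mul_inv_cancel₀ hn.ne', one_smul]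
        have h := hcrit (‖(v:X)‖⁻¹ • (v:X)) ‖(v:X)‖
          (smul_ne_zero (inv_ne_zero hn.ne') v.2.1) hn (by
            rw [hw, map_smul, v.2.2, smul_zero])
        show tu (‖(v:X)‖⁻¹ • (v:X)) • (‖(v:X)‖⁻¹ • (v:X)) = (v:X)
        rw [← h, hw] }
  refine ⟨{ e with
    continuous_toFun := Continuous.subtype_mk (htc.smul continuous_subtype_val) _
    continuous_invFun := Continuous.subtype_mk
      ((continuous_subtype_val.norm.inv₀ fun v => norm_ne_zero_iff.2 v.2.1).smul
        continuous_subtype_val) _ }, fun u => rfl, fun v => rfl⟩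

theorem nehari_homeomorphism
    -- `X` plays the role of the Sobolev space `H¹₀(Ω)`, with `‖u‖² = ∫_Ω |∇u|²`,
    -- and `T u` is the function on `Ω` represented by `u ∈ X`.
    {X : Type*} [NormedAddCommGroup X] [InnerProductSpace ℝ X] [CompleteSpace X]
    {N : ℕ} (hN : 1 ≤ N ∧ N ≤ 3)
    (Ω : Set (EuclideanSpace ℝ (Fin N)))
    (hΩopen : IsOpen Ω) (hΩbdd : Bornology.IsBounded Ω)
    (T : X →ₗ[ℝ] (EuclideanSpace ℝ (Fin N) → ℝ))
    (a b : ℝ) (ha : 0 < a) (hb : 0 < b)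
    (f F : EuclideanSpace ℝ (Fin N) → ℝ → ℝ)
    (hF : ∀ x u, F x u = ∫ s in (0:ℝ)..u, f x s)
    (c p : ℝ) (hc : 0 < c) (hp : 4 < p) (hp3 : N = 3 → p < 6)
    -- (f₁): continuity and subcritical growth
    (hf1 : Continuous fun q : EuclideanSpace ℝ (Fin N) × ℝ => f q.1 q.2)
    (hf1' : ∀ x ∈ closure Ω, ∀ u : ℝ, |f x u| ≤ c * (1 + |u| ^ (p - 1)))
    -- (f₂): f(x,u) = o(u) as u → 0, uniformly in x
    (hf2 : ∀ ε : ℝ, 0 < ε → ∃ δ : ℝ, 0 < δ ∧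
      ∀ x ∈ closure Ω, ∀ u : ℝ, |u| ≤ δ → |f x u| ≤ ε * |u|)
    -- (f₃): F(x,u)/u⁴ → ∞ as |u| → ∞, uniformly in x
    (hf3 : ∀ M : ℝ, ∃ R : ℝ, 0 < R ∧
      ∀ x ∈ closure Ω, ∀ u : ℝ, R ≤ |u| → M ≤ F x u / u ^ 4)
    -- (f₄): u ↦ f(x,u)/u³ positive for u ≠ 0, nonincreasing on (−∞,0),
    -- nondecreasing on (0,∞)
    (hf4pos : ∀ x ∈ closure Ω, ∀ u : ℝ, u ≠ 0 → 0 < f x u / u ^ 3)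
    (hf4mono : ∀ x ∈ closure Ω,
      MonotoneOn (fun u => f x u / u ^ 3) (Set.Ioi (0:ℝ)))
    (hf4anti : ∀ x ∈ closure Ω,
      AntitoneOn (fun u => f x u / u ^ 3) (Set.Iio (0:ℝ)))
    -- the energy functional
    (Φ : X → ℝ)
    (hΦ : ∀ u : X, Φ u = a / 2 * ‖u‖ ^ 2 + b / 4 * ‖u‖ ^ 4
      - ∫ x in Ω, F x (T u x))
    (Φ' : X → X →L[ℝ] ℝ) (hΦ' : ∀ u : X, HasFDerivAt Φ (Φ' u) u)
    -- `tu u` is the unique positive maximizer of `t ↦ Φ(t • u)`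
    (tu : X → ℝ)
    (htu : ∀ u : X, u ≠ 0 → 0 < tu u ∧
      ∀ t : ℝ, 0 < t → t ≠ tu u → Φ (t • u) < Φ (tu u • u)) :
    -- M(u) = tu u • u is a homeomorphism from the unit sphere onto the
    -- Nehari manifold, with inverse u ↦ u / ‖u‖
    ∃ M : {u : X // ‖u‖ = 1} ≃ₜ {u : X // u ≠ 0 ∧ Φ' u u = 0},
      (∀ u : {u : X // ‖u‖ = 1}, (M u : X) = tu u • (u : X)) ∧
      (∀ v : {u : X // u ≠ 0 ∧ Φ' u u = 0},
        (M.symm v : X) = ‖(v : X)‖⁻¹ • (v : X)) := by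
  have hfc : ∀ x, Continuous (f x) := fun x =>
    hf1.comp (Continuous.prodMk continuous_const continuous_id)
  have hFc : ∀ x, Continuous (F x) := by
    intro x
    have : F x = fun u => ∫ s in (0:ℝ)..u, f x s := funext (hF x)
    rw [this]
    exact intervalIntegral.continuous_primitive (fun _ _ => (hfc x).intervalIntegrable _ _) 0
  have hF0 : ∀ x, F x 0 = 0 := fun x => by rw [hF, intervalIntegral.integral_same]
  have hFpos : ∀ x ∈ Ω, ∀ v, v ≠ 0 → 0 < F x v := fun x hx v hv =>
    primitive_pos (f x) (F x) (hfc x) (hF x) (hf4pos x (subset_closure hx)) v hv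
  have hFnn : ∀ x ∈ Ω, ∀ v, 0 ≤ F x v := fun x hx v => by
    rcases eq_or_ne v 0 with h | h
    · rw [h, hF0]
    · exact (hFpos x hx v h).le
  have hae : ∀ {P : EuclideanSpace ℝ (Fin N) → Prop}, (∀ x ∈ Ω, P x) →
      ∀ᵐ x ∂(MeasureTheory.volume.restrict Ω), P x := fun h =>
    MeasureTheory.ae_restrict_of_forall_mem hΩopen.measurableSet h
  have hΦc : Continuous Φ := continuous_iff_continuousAt.2 fun u => (hΦ' u).continuousAt
  have hgeq : ∀ (u : X) (t : ℝ), ∫ x in Ω, F x (t * T u x) =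
      a / 2 * ‖t • u‖ ^ 2 + b / 4 * ‖t • u‖ ^ 4 - Φ (t • u) := by
    intro u t
    rw [hΦ, map_smul]
    simp
  have hint : ∀ u : X, u ≠ 0 → ∀ t : ℝ, 0 < t →
      MeasureTheory.IntegrableOn (fun x => F x (t * T u x)) Ω := by
    intro u hu
    have hun : 0 < ‖u‖ := norm_pos_iff.2 hu
    obtain ⟨htp, hstr⟩ := htu u hu
    have hex : ∃ t₁ : ℝ, 0 < t₁ ∧ ∫ x in Ω, F x (t₁ * T u x) ≠ 0 := by
      by_contra! hcon
      have h1 := hcon _ htp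
      have h2 := hcon (2 * tu u) (by positivity)
      rw [hgeq, norm_smul, Real.norm_eq_abs, abs_of_pos htp] at h1
      rw [hgeq, norm_smul, Real.norm_eq_abs, abs_of_pos (by positivity)] at h2
      have h3 := hstr (2 * tu u) (by positivity) (by linarith)
      have h4 : 0 < a * (tu u * ‖u‖) ^ 2 := by positivity
      have h5 : 0 < b * (tu u * ‖u‖) ^ 4 := by positivity
      nlinarith
    obtain ⟨t₁, ht₁, hne⟩ := hex
    refine integrable_of_continuous_integral (fun t x => F x (t * T u x)) ?_ ?_ ?_ ?_ t₁ ht₁ hne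
    · exact hae fun x _ => (hFc x).comp (continuous_id.mul continuous_const)
    · exact fun t => hae fun x hx => hFnn x hx _
    · intro t s ht hs
      refine hae fun x hx h => ?_
      by_contra hn
      have : T u x = 0 := by
        by_contra h'
        exact (hFpos x hx _ (mul_ne_zero ht.ne' h')).ne' h
      rw [this, mul_zero, hF0] at hn
      exact hn rfl
    · simp_rw [hgeq]
      have hs : Continuous fun t : ℝ => t • u := continuous_id.smul continuous_const
      exact ((continuous_const.mul (hs.norm.pow 2)).add
        (continuous_const.mul (hs.norm.pow 4))).sub (hΦc.comp hs)
  refine nehari_abstract Φ Φ' hΦ' tu htu fun u hu => ?_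
  have hconv : ConvexOn ℝ (Set.Ioi (0:ℝ)) fun s : ℝ => ∫ x in Ω, F x (s ^ (1/4:ℝ) * T u x) := by
    refine ⟨convex_Ioi 0, fun s hs t ht α β hα hβ hαβ => ?_⟩
    have hst : 0 < α • s + β • t := convex_Ioi (0:ℝ) hs ht hα hβ hαβ
    have hIs := hint u hu _ (Real.rpow_pos_of_pos hs (1/4:ℝ))
    have hIt := hint u hu _ (Real.rpow_pos_of_pos ht (1/4:ℝ))
    have hIst := hint u hu _ (Real.rpow_pos_of_pos hst (1/4:ℝ))
    simp only [smul_eq_mul] at *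
    rw [← MeasureTheory.integral_const_mul, ← MeasureTheory.integral_const_mul,
      ← MeasureTheory.integral_add (hIs.const_mul α) (hIt.const_mul β)]
    refine MeasureTheory.setIntegral_mono_on hIst
      ((hIs.const_mul α).add (hIt.const_mul β)) hΩopen.measurableSet fun x hx => ?_
    have hx' := subset_closure hx
    exact (convexOn_quarter (f x) (F x) (hfc x) (hF x) (hf4mono x hx') (hf4anti x hx')
      (T u x)).2 hs ht hα hβ hαβ
  have hsq : ConcaveOn ℝ (Set.Ioi (0:ℝ)) fun s : ℝ => s ^ (1/2:ℝ) :=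
    (Real.concaveOn_rpow (by norm_num) (by norm_num)).subset Set.Ioi_subset_Ici_self
      (convex_Ioi 0)
  have hid : ConcaveOn ℝ (Set.Ioi (0:ℝ)) fun s : ℝ => s := concaveOn_id (convex_Ioi 0)
  have hall := ((hsq.smul (c := a / 2 * ‖u‖ ^ 2) (by positivity)).add
    (hid.smul (c := b / 4 * ‖u‖ ^ 4) (by positivity))).sub hconv
  refine hall.congr fun s hs => ?_
  have hs' : 0 < s := hs
  have hq : 0 < s ^ (1/4:ℝ) := Real.rpow_pos_of_pos hs' _
  have hq4 : (s ^ (1/4:ℝ)) ^ 4 = s := by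
    rw [← Real.rpow_natCast, ← Real.rpow_mul hs'.le]; norm_num
  have hq2 : (s ^ (1/4:ℝ)) ^ 2 = s ^ (1/2:ℝ) := by
    rw [← Real.rpow_natCast, ← Real.rpow_mul hs'.le]; norm_num
  have := hgeq u (s ^ (1/4:ℝ))
  simp only [Pi.add_apply, Pi.sub_apply, smul_eq_mul]
  rw [this, norm_smul, Real.norm_eq_abs, abs_of_pos hq, mul_pow, mul_pow, hq4, hq2]
  ring
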